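/- Let (M_p)_{p∈ℕ₀} be a sequence of positive real numbers, let K ⊂ ℝ^d be a compact set, and let φ : ℝ^d → ℂ be a smooth function with support contained in K. Then the following are equivalent: (i) there exists h > 0 such that sup_{k∈ℕ₀^d} ‖D^kφ‖_K / (h^{|k|} M_{|k|}) < ∞; (ii) for every (r_p) ∈ 𝔯, sup_{k∈ℕ₀^d} ‖D^kφ‖_K / (R_{|k|} M_{|k|}) < ∞, where (R_p) is the product sequence corresponding to (r_p). (This is the membership form of the projective description 𝒟_K^{{M_p}} = proj lim_{(r_p)∈𝔯} 𝒟_{K,(r_p)}^{{M_p}}.) -/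

import Mathlib

open scoped ENNReal

noncomputable section

/-- The class 𝔯: positive sequences with `r 0 = 1`, monotonically increasing,
tending to infinity. -/
def IsRSeq (r : ℕ → ℝ) : Prop :=
  r 0 = 1 ∧ (∀ p, 0 < r p) ∧ Monotone r ∧ Filter.Tendsto r Filter.atTop Filter.atTop

/-- The product sequence `R p = r 0 * r 1 * ⋯ * r p` (so `R 0 = r 0 = 1`). -/
def prodSeq (r : ℕ → ℝ) (p : ℕ) : ℝ := ∏ i ∈ Finset.range (p + 1), r i

/-- The one-dimensional operator `D_m = (1/i) ∂/∂x_m` acting on functions on `ℝ^d`. -/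
def Dm {d : ℕ} (m : Fin d) (f : (Fin d → ℝ) → ℂ) : (Fin d → ℝ) → ℂ :=
  fun x => -Complex.I * fderiv ℝ f x (Pi.single m 1)

/-- The multi-index derivative `D^k = D_1^{k_1} ⋯ D_d^{k_d}`. -/
def Dmulti {d : ℕ} (k : Fin d → ℕ) (f : (Fin d → ℝ) → ℂ) : (Fin d → ℝ) → ℂ :=
  ((List.ofFn fun m : Fin d => (Dm m)^[k m]).foldr (· ∘ ·) id) f

theorem aux_Dm {d : ℕ} (m : Fin d) (f : (Fin d → ℝ) → ℂ) (hf : ContDiff ℝ (⊤ : ℕ∞) f) :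
    ContDiff ℝ (⊤ : ℕ∞) (Dm m f) := by
  unfold Dm
  have h1 : ContDiff ℝ (⊤ : ℕ∞) (fderiv ℝ f) := hf.fderiv_right (by simp)
  exact contDiff_const.mul (h1.clm_apply contDiff_const)

theorem aux_Dmulti {d : ℕ} (k : Fin d → ℕ) (f : (Fin d → ℝ) → ℂ)
    (hf : ContDiff ℝ (⊤ : ℕ∞) f) : ContDiff ℝ (⊤ : ℕ∞) (Dmulti k f) := by
  unfold Dmulti
  have key : ∀ l : List (((Fin d → ℝ) → ℂ) → ((Fin d → ℝ) → ℂ)),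
      (∀ T ∈ l, ∀ g, ContDiff ℝ (⊤ : ℕ∞) g → ContDiff ℝ (⊤ : ℕ∞) (T g)) →
      ContDiff ℝ (⊤ : ℕ∞) ((l.foldr (· ∘ ·) id) f) := by
    intro l
    induction l with
    | nil => intro _; simpa using hf
    | cons T l ih =>
      intro h
      simp only [List.foldr_cons, Function.comp_apply]
      exact h T (by simp) _ (ih fun S hS => h S (by simp [hS]))
  apply key
  intro T hT g hg
  rw [List.mem_ofFn] at hT
  obtain ⟨m, rfl⟩ := hT
  induction k m with
  | zero => simpa using hg
  | succ n ih => rw [Function.iterate_succ_apply']; exact aux_Dm m _ ih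

theorem aux_sup {ι : Type*} (A : ι → ℝ≥0∞) (hA : ∀ k, A k ≠ ⊤) (w : ι → ℝ) (hw : ∀ k, 0 < w k) :
    (⨆ k, A k / ENNReal.ofReal (w k)) < ⊤ ↔ ∃ C : ℝ, ∀ k, (A k).toReal ≤ C * w k := by
  have e : ∀ k, A k / ENNReal.ofReal (w k) = ENNReal.ofReal ((A k).toReal / w k) := by
    intro k
    rw [ENNReal.ofReal_div_of_pos (hw k), ENNReal.ofReal_toReal (hA k)]
  simp_rw [e]
  constructor
  · intro h
    refine ⟨(⨆ k, ENNReal.ofReal ((A k).toReal / w k)).toReal, fun k => ?_⟩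
    rw [← div_le_iff₀ (hw k)]
    exact (ENNReal.ofReal_le_iff_le_toReal h.ne).1
      (le_iSup (fun k => ENNReal.ofReal ((A k).toReal / w k)) k)
  · rintro ⟨C, hC⟩
    refine lt_of_le_of_lt (iSup_le fun k => ?_) (ENNReal.ofReal_lt_top (r := C))
    exact ENNReal.ofReal_le_ofReal ((div_le_iff₀ (hw k)).2 (hC k))

theorem aux_prod_succ (r : ℕ → ℝ) (p : ℕ) : prodSeq r (p + 1) = prodSeq r p * r (p + 1) := by
  unfold prodSeq; rw [Finset.prod_range_succ]

theorem aux_prod_pos (r : ℕ → ℝ) (hr : ∀ p, 0 < r p) (p : ℕ) : 0 < prodSeq r p :=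
  Finset.prod_pos fun i _ => hr i

theorem aux_lower (r : ℕ → ℝ) (hr : IsRSeq r) (h : ℝ) (hh : 0 < h) :
    ∃ C : ℝ, 0 < C ∧ ∀ p, h ^ p ≤ C * prodSeq r p := by
  obtain ⟨h0, hpos, hmono, hlim⟩ := hr
  obtain ⟨q, hq⟩ := (hlim.eventually_ge_atTop h).exists_forall_of_atTop
  have hP := aux_prod_pos r hpos
  let C : ℝ := ∑ i ∈ Finset.range (q + 1), h ^ i / prodSeq r i
  have hsmall : ∀ p ≤ q, h ^ p ≤ C * prodSeq r p := by
    intro p hp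
    rw [← div_le_iff₀ (hP p)]
    exact Finset.single_le_sum (f := fun i => h ^ i / prodSeq r i)
      (fun i _ => (div_pos (pow_pos hh i) (hP i)).le) (Finset.mem_range.2 (by omega))
  have hC : 0 < C := Finset.sum_pos (fun i _ => div_pos (pow_pos hh i) (hP i)) (by simp)
  refine ⟨C, hC, fun p => ?_⟩
  induction p with
  | zero => exact hsmall 0 (Nat.zero_le _)
  | succ p ih =>
    by_cases hp : p + 1 ≤ q
    · exact hsmall _ hp
    · rw [pow_succ, aux_prod_succ, ← mul_assoc]
      exact mul_le_mul ih (hq _ (by omega)) hh.le (mul_pos hC (hP p)).le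

theorem aux_construct (P : ℕ → ℕ) (hP : StrictMono P) :
    ∃ r : ℕ → ℝ, IsRSeq r ∧ ∀ n, prodSeq r (P n) ≤ ((n : ℝ) + 1) ^ (P n) := by
  let c : ℕ → ℕ := fun p => ((Finset.range p).filter fun n => P n < p).card
  have hle : ∀ n p, p ≤ P n → c p ≤ n := by
    intro n p hp
    have : ((Finset.range p).filter fun n => P n < p) ⊆ Finset.range n := by
      intro m hm
      rw [Finset.mem_filter] at hm
      exact Finset.mem_range.2 (hP.lt_iff_lt.1 (lt_of_lt_of_le hm.2 hp))
    simpa using Finset.card_le_card this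
  have hge : ∀ n p, P n < p → n ≤ c p := by
    intro n p hp
    have : Finset.range n ⊆ ((Finset.range p).filter fun n => P n < p) := by
      intro m hm
      have h1 := hP (Finset.mem_range.1 hm)
      have h2 := hP.id_le m
      simp only [id] at h2
      rw [Finset.mem_filter, Finset.mem_range]
      omega
    simpa using Finset.card_le_card this
  have hr0 : ((c 0 : ℕ) : ℝ) + 1 = 1 := by simp [c]
  refine ⟨fun p => (c p : ℝ) + 1, ⟨hr0, fun p => by positivity, ?_, ?_⟩, ?_⟩
  · intro p q hpq
    have : c p ≤ c q := by
      apply Finset.card_le_card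
      intro m hm
      rw [Finset.mem_filter, Finset.mem_range] at *
      omega
    have : (c p : ℝ) ≤ c q := by exact_mod_cast this
    simpa using this
  · rw [Filter.tendsto_atTop]
    intro b
    obtain ⟨n, hn⟩ := exists_nat_ge b
    filter_upwards [Filter.eventually_gt_atTop (P n)] with p hp
    have : (n : ℝ) ≤ c p := by exact_mod_cast hge n p hp
    linarith
  · intro n
    unfold prodSeq
    rw [Finset.prod_range_succ', hr0, mul_one]
    calc _ ≤ ∏ i ∈ Finset.range (P n), ((n : ℝ) + 1) := by
          apply Finset.prod_le_prod
          · intro i _; positivity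
          · intro i hi
            have : (c (i+1) : ℝ) ≤ n := by
              exact_mod_cast hle n (i+1) (Finset.mem_range.1 hi)
            linarith
      _ = _ := by simp

theorem aux_main {ι : Type*} (N : ι → ℕ) (hN : ∀ q, {k | N k ≤ q}.Finite) (B : ι → ℝ) :
    (∃ h : ℝ, 0 < h ∧ ∃ C : ℝ, ∀ k, B k ≤ C * h ^ N k) ↔
    ∀ r : ℕ → ℝ, IsRSeq r → ∃ C : ℝ, ∀ k, B k ≤ C * prodSeq r (N k) := by
  constructor
  · rintro ⟨h, hh, C, hC⟩ r hr
    obtain ⟨E, hE, hle⟩ := aux_lower r hr h hh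
    refine ⟨|C| * E, fun k => (hC k).trans ?_⟩
    calc C * h ^ N k ≤ |C| * h ^ N k := by gcongr; exact le_abs_self C
      _ ≤ |C| * (E * prodSeq r (N k)) := by gcongr; exact hle _
      _ = _ := by ring
  · intro H
    by_contra hcon
    push Not at hcon
    have step : ∀ n q : ℕ, ∃ k, q < N k ∧ ((n : ℝ) + 1) * ((n : ℝ) + 1) ^ N k < B k := by
      intro n q
      obtain ⟨b, hb⟩ := ((hN q).image B).bddAbove
      obtain ⟨k, hk⟩ := hcon ((n : ℝ) + 1) (by positivity) (max b (n + 1))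
      have h1 : (1 : ℝ) ≤ ((n : ℝ) + 1) ^ N k := one_le_pow₀ (by simp)
      have h0 : (0 : ℝ) ≤ max b (n + 1) := le_max_of_le_right (by positivity)
      refine ⟨k, ?_, lt_of_le_of_lt ?_ hk⟩
      · by_contra hle
        have h2 : B k ≤ b := hb ⟨k, not_lt.1 hle, rfl⟩
        have h3 := le_max_left b ((n : ℝ) + 1)
        nlinarith
      · gcongr
        exact le_max_right _ _
    choose F hF1 hF2 using step
    let κ : ℕ → ι := fun n => Nat.rec (F 0 0) (fun m k => F (m + 1) (N k)) n
    have hmono : StrictMono fun n => N (κ n) :=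
      strictMono_nat_of_lt_succ fun n => hF1 (n + 1) (N (κ n))
    have hbig : ∀ n : ℕ, ((n : ℝ) + 1) * ((n : ℝ) + 1) ^ N (κ n) < B (κ n) := by
      intro n
      cases n with
      | zero => exact hF2 0 0
      | succ n => exact hF2 (n + 1) (N (κ n))
    obtain ⟨r, hr, hle⟩ := aux_construct _ hmono
    obtain ⟨C, hC⟩ := H r hr
    obtain ⟨n, hn⟩ := exists_nat_ge C
    have h1 := hC (κ n)
    have h2 := hbig n
    have h3 := hle n
    have h4 := aux_prod_pos r hr.2.1 (N (κ n))
    have h5 : C * prodSeq r (N (κ n)) ≤ ((n : ℝ) + 1) * ((n : ℝ) + 1) ^ N (κ n) :=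
      mul_le_mul (by linarith) h3 h4.le (by positivity)
    linarith

/-- Projective description of `𝒟_K^{M_p}` (membership form): for a smooth `φ`
supported in a compact set `K`, there exists `h > 0` with
`sup_k ‖D^k φ‖_K / (h^{|k|} M_{|k|}) < ∞` iff for every `(r p) ∈ 𝔯` one has
`sup_k ‖D^k φ‖_K / (R_{|k|} M_{|k|}) < ∞`. -/
theorem stmt7 (d : ℕ) (M : ℕ → ℝ) (hM : ∀ p, 0 < M p)
    (K : Set (Fin d → ℝ)) (hK : IsCompact K)
    (φ : (Fin d → ℝ) → ℂ) (hφ : ContDiff ℝ (⊤ : ℕ∞) φ) (hsupp : tsupport φ ⊆ K) :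
    (∃ h : ℝ, 0 < h ∧
        (⨆ k : Fin d → ℕ, (⨆ x ∈ K, (‖Dmulti k φ x‖₊ : ℝ≥0∞)) /
          ENNReal.ofReal (h ^ (∑ m, k m) * M (∑ m, k m))) < ⊤) ↔
      ∀ r : ℕ → ℝ, IsRSeq r →
        (⨆ k : Fin d → ℕ, (⨆ x ∈ K, (‖Dmulti k φ x‖₊ : ℝ≥0∞)) /
          ENNReal.ofReal (prodSeq r (∑ m, k m) * M (∑ m, k m))) < ⊤ := by
  have hA : ∀ k : Fin d → ℕ, (⨆ x ∈ K, (‖Dmulti k φ x‖₊ : ℝ≥0∞)) ≠ ⊤ := by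
    intro k
    obtain ⟨C, hC⟩ := hK.exists_bound_of_continuousOn (aux_Dmulti k φ hφ).continuous.continuousOn
    refine ne_top_of_le_ne_top (ENNReal.ofReal_ne_top (r := C)) (iSup₂_le fun x hx => ?_)
    rw [← enorm_eq_nnnorm, ← ofReal_norm]
    exact ENNReal.ofReal_le_ofReal (hC x hx)
  have hN : ∀ q, {k : Fin d → ℕ | ∑ m, k m ≤ q}.Finite := by
    intro q
    refine (Set.finite_Iic (fun _ : Fin d => q)).subset fun k hk m => ?_
    exact (Finset.single_le_sum (f := k) (fun _ _ => Nat.zero_le _) (Finset.mem_univ m)).trans hk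
  have hmain := aux_main (fun k : Fin d → ℕ => ∑ m, k m) hN
    (fun k => (⨆ x ∈ K, (‖Dmulti k φ x‖₊ : ℝ≥0∞)).toReal / M (∑ m, k m))
  have conv : ∀ w : ℕ → ℝ, (∀ p, 0 < w p) →
      ((⨆ k : Fin d → ℕ, (⨆ x ∈ K, (‖Dmulti k φ x‖₊ : ℝ≥0∞)) /
          ENNReal.ofReal (w (∑ m, k m) * M (∑ m, k m))) < ⊤ ↔
        ∃ C : ℝ, ∀ k : Fin d → ℕ,
          (⨆ x ∈ K, (‖Dmulti k φ x‖₊ : ℝ≥0∞)).toReal / M (∑ m, k m) ≤ C * w (∑ m, k m)) := by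
    intro w hw
    rw [aux_sup _ hA (fun k => w (∑ m, k m) * M (∑ m, k m)) fun k => mul_pos (hw _) (hM _)]
    simp_rw [div_le_iff₀ (hM _), mul_assoc]
  constructor
  · rintro ⟨h, hh, hs⟩ r hr
    rw [conv (prodSeq r) (aux_prod_pos r hr.2.1)]
    exact hmain.1 ⟨h, hh, (conv (fun p => h ^ p) fun p => pow_pos hh p).1 hs⟩ r hr
  · intro H
    obtain ⟨h, hh, hs⟩ := hmain.2 fun r hr => (conv (prodSeq r) (aux_prod_pos r hr.2.1)).1 (H r hr)
    exact ⟨h, hh, (conv (fun p => h ^ p) fun p => pow_pos hh p).2 hs⟩
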